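/- Let R be a skew-invertible Hecke symmetry on V = ℂ^N with parameter q (q ≠ 0, q ≠ ±1), let L(R) be the associated reflection equation algebra with generating matrix L, and let n ≥ 1. For every matrix P ∈ End(V^{⊗n}) that is a (noncommutative) polynomial with complex coefficients in R₁, …, R_{n−1}, one has the equality Tr_{R(1…n)}( P · L_{\bar{1→n}} ) = Tr_{R(1…n)}( L_{\bar{1→n}} · P ) in L(R). -/

import Mathlib

open scoped BigOperators

/-- Amplification of an operator on V⊗V to positions (k, k+1) (0-based) of V^{⊗n}. -/
def ampl2 {A : Type*} [Semiring A] (N n : ℕ)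
    (M : Matrix (Fin N × Fin N) (Fin N × Fin N) A) (k : ℕ) :
    Matrix (Fin n → Fin N) (Fin n → Fin N) A := fun i j =>
  if h : k + 1 < n then
    if ∀ m : Fin n, (m : ℕ) ≠ k → (m : ℕ) ≠ k + 1 → i m = j m then
      M (i ⟨k, Nat.lt_of_succ_lt h⟩, i ⟨k + 1, h⟩)
        (j ⟨k, Nat.lt_of_succ_lt h⟩, j ⟨k + 1, h⟩)
    else 0
  else 0

/-- Amplification of an operator on V to position k (0-based) of V^{⊗n}. -/
def ampl1 {A : Type*} [Semiring A] (N n : ℕ)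
    (X : Matrix (Fin N) (Fin N) A) (k : ℕ) :
    Matrix (Fin n → Fin N) (Fin n → Fin N) A := fun i j =>
  if h : k < n then
    if ∀ m : Fin n, (m : ℕ) ≠ k → i m = j m then
      X (i ⟨k, h⟩) (j ⟨k, h⟩)
    else 0
  else 0

/-- The R-trace of an N×N matrix over an algebra. -/
noncomputable def trR1 {A : Type*} [Ring A] [Algebra ℂ A] (N : ℕ)
    (C : Matrix (Fin N) (Fin N) ℂ) (X : Matrix (Fin N) (Fin N) A) : A :=
  ∑ i : Fin N, ∑ j : Fin N, algebraMap ℂ A (C i j) * X j i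

/-- The full R-trace over all n tensor positions. -/
noncomputable def trRn {A : Type*} [Ring A] [Algebra ℂ A] (N n : ℕ)
    (C : Matrix (Fin N) (Fin N) ℂ)
    (M : Matrix (Fin n → Fin N) (Fin n → Fin N) A) : A :=
  ∑ i : Fin n → Fin N, ∑ j : Fin n → Fin N,
    algebraMap ℂ A (∏ k : Fin n, C (i k) (j k)) * M j i

/-- The matrix L⊗I over the free algebra on N² generators. -/
noncomputable def L1F (N : ℕ) :
    Matrix (Fin N × Fin N) (Fin N × Fin N) (FreeAlgebra ℂ (Fin N × Fin N)) :=
  fun p r => if p.2 = r.2 then FreeAlgebra.ι ℂ (p.1, r.1) else 0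

/-- Defining relations of the reflection equation algebra. -/
inductive REArel (N : ℕ) (R : Matrix (Fin N × Fin N) (Fin N × Fin N) ℂ) :
    FreeAlgebra ℂ (Fin N × Fin N) → FreeAlgebra ℂ (Fin N × Fin N) → Prop
  | rel (p r : Fin N × Fin N) :
      REArel N R
        ((R.map (algebraMap ℂ (FreeAlgebra ℂ (Fin N × Fin N))) * L1F N *
            R.map (algebraMap ℂ (FreeAlgebra ℂ (Fin N × Fin N))) * L1F N) p r)
        ((L1F N * R.map (algebraMap ℂ (FreeAlgebra ℂ (Fin N × Fin N))) * L1F N *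
            R.map (algebraMap ℂ (FreeAlgebra ℂ (Fin N × Fin N)))) p r)

/-- The reflection equation algebra L(R). -/
abbrev REA (N : ℕ) (R : Matrix (Fin N × Fin N) (Fin N × Fin N) ℂ) := RingQuot (REArel N R)

/-- The generating matrix of the RE algebra. -/
noncomputable def Lgen (N : ℕ) (R : Matrix (Fin N × Fin N) (Fin N × Fin N) ℂ) :
    Matrix (Fin N) (Fin N) (REA N R) :=
  fun i j => RingQuot.mkAlgHom ℂ (REArel N R) (FreeAlgebra.ι ℂ (i, j))

/-- Defining relations of the modified reflection equation algebra. -/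
inductive MREArel (N : ℕ) (R : Matrix (Fin N × Fin N) (Fin N × Fin N) ℂ) :
    FreeAlgebra ℂ (Fin N × Fin N) → FreeAlgebra ℂ (Fin N × Fin N) → Prop
  | rel (p r : Fin N × Fin N) :
      MREArel N R
        ((R.map (algebraMap ℂ (FreeAlgebra ℂ (Fin N × Fin N))) * L1F N *
            R.map (algebraMap ℂ (FreeAlgebra ℂ (Fin N × Fin N))) * L1F N -
          L1F N * R.map (algebraMap ℂ (FreeAlgebra ℂ (Fin N × Fin N))) * L1F N *
            R.map (algebraMap ℂ (FreeAlgebra ℂ (Fin N × Fin N)))) p r)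
        ((R.map (algebraMap ℂ (FreeAlgebra ℂ (Fin N × Fin N))) * L1F N -
          L1F N * R.map (algebraMap ℂ (FreeAlgebra ℂ (Fin N × Fin N)))) p r)

/-- The modified reflection equation algebra L̂(R). -/
abbrev MREA (N : ℕ) (R : Matrix (Fin N × Fin N) (Fin N × Fin N) ℂ) := RingQuot (MREArel N R)

/-- The generating matrix of the modified RE algebra. -/
noncomputable def Lhatgen (N : ℕ) (R : Matrix (Fin N × Fin N) (Fin N × Fin N) ℂ) :
    Matrix (Fin N) (Fin N) (MREA N R) :=
  fun i j => RingQuot.mkAlgHom ℂ (MREArel N R) (FreeAlgebra.ι ℂ (i, j))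

/-- The matrices L_{\bar k}, 0-based: Lbar 0 = L₁, Lbar k = R_k Lbar (k-1) R_k⁻¹,
with R⁻¹ = R - (q - q⁻¹)I. -/
noncomputable def Lbar {A : Type*} [Ring A] [Algebra ℂ A] (N n : ℕ)
    (R : Matrix (Fin N × Fin N) (Fin N × Fin N) ℂ) (q : ℂ)
    (L : Matrix (Fin N) (Fin N) A) : ℕ → Matrix (Fin n → Fin N) (Fin n → Fin N) A
  | 0 => ampl1 N n L 0
  | k + 1 =>
      ampl2 N n (R.map (algebraMap ℂ A)) k * Lbar N n R q L k *
        ampl2 N n ((R - (q - q⁻¹) • 1).map (algebraMap ℂ A)) k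

/-- The ordered product L_{\bar 1} L_{\bar 2} ⋯ L_{\bar n}. -/
noncomputable def Ltot {A : Type*} [Ring A] [Algebra ℂ A] (N n : ℕ)
    (R : Matrix (Fin N × Fin N) (Fin N × Fin N) ℂ) (q : ℂ)
    (L : Matrix (Fin N) (Fin N) A) : Matrix (Fin n → Fin N) (Fin n → Fin N) A :=
  ((List.range n).map (Lbar N n R q L)).prod


section Abstract

variable {M : Type*} [Ring M]

lemma aux_comm_inv {a r s : M} (h1 : r * s = 1) (h2 : s * r = 1) (h : Commute a r) :
    Commute a s := by
  have h' : a * r = r * a := h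
  show a * s = s * a
  calc a * s = s * (r * a) * s := by rw [← mul_assoc, h2, one_mul]
    _ = s * a * (r * s) := by rw [← h']; simp only [mul_assoc]
    _ = s * a := by rw [h1, mul_one]

lemma aux_conj {a a' b b' : M} (ha : a * a' = 1) (ha' : a' * a = 1) (hb : b * b' = 1)
    (hb' : b' * b = 1) (hbr : a * b * a = b * a * b) :
    a' * b * a = b * a * b' ∧ b' * a' * b = a * b' * a' ∧ a * b' * a' = b' * a' * b := by
  have h1 : a' * b * a = b * a * b' := by
    calc a' * b * a = a' * (b * a * b) * b' := by
          simp only [mul_assoc]; rw [hb, mul_one]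
      _ = (a' * a) * b * a * b' := by rw [← hbr]; simp only [mul_assoc]
      _ = b * a * b' := by rw [ha', one_mul]
  have h2 : b' * a' * b = a * b' * a' := by
    calc b' * a' * b = b' * (a' * b * a) * a' := by
          simp only [mul_assoc]; rw [ha, mul_one]
      _ = (b' * b) * a * b' * a' := by rw [h1]; simp only [mul_assoc]
      _ = a * b' * a' := by rw [hb', one_mul]
  exact ⟨h1, h2, h2.symm⟩

lemma aux_step {a a' b b' X : M} (ha : a * a' = 1) (ha' : a' * a = 1) (hb : b * b' = 1)
    (hb' : b' * b = 1) (hbr : a * b * a = b * a * b) (hbX : Commute b X)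
    (h : a * X * a * X = X * a * X * a) :
    b * (a * X * a') * b * (a * X * a') = (a * X * a') * b * (a * X * a') * b := by
  obtain ⟨h1, h2, -⟩ := aux_conj ha ha' hb hb' hbr
  have e1 : b * X = X * b := hbX
  have e2 : X * b' = b' * X := aux_comm_inv hb hb' hbX.symm
  calc b * (a * X * a') * b * (a * X * a') = b * a * X * (a' * b * a) * X * a' := by
        simp only [mul_assoc]
    _ = b * a * (X * b) * a * (b' * X) * a' := by rw [h1]; simp only [mul_assoc]
    _ = (b * a * b) * X * a * X * b' * a' := by rw [← e1, ← e2]; simp only [mul_assoc]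
    _ = a * b * (a * X * a * X) * b' * a' := by rw [← hbr]; simp only [mul_assoc]
    _ = a * (b * X) * a * X * (a * b' * a') := by rw [h]; simp only [mul_assoc]
    _ = a * X * b * a * (X * b') * a' * b := by rw [← h2, e1]; simp only [mul_assoc]
    _ = a * X * (b * a * b') * X * a' * b := by rw [e2]; simp only [mul_assoc]
    _ = (a * X * a') * b * (a * X * a') * b := by rw [← h1]; simp only [mul_assoc]

lemma aux_two {a a' b b' X : M} (ha : a * a' = 1) (ha' : a' * a = 1) (hb : b * b' = 1)
    (hb' : b' * b = 1) (hbr : a * b * a = b * a * b) (hbX : Commute b X) :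
    Commute a (b * (a * X * a') * b') := by
  obtain ⟨-, -, h3⟩ := aux_conj hb hb' ha ha' hbr.symm
  have e1 : b * X = X * b := hbX
  show a * (b * (a * X * a') * b') = b * (a * X * a') * b' * a
  calc a * (b * (a * X * a') * b') = (a * b * a) * X * a' * b' := by simp only [mul_assoc]
    _ = b * a * (b * X) * a' * b' := by rw [hbr]; simp only [mul_assoc]
    _ = b * a * X * (b * a' * b') := by rw [e1]; simp only [mul_assoc]
    _ = b * (a * X * a') * b' * a := by rw [h3]; simp only [mul_assoc]

theorem abstract_comm (n : ℕ) (r s l : ℕ → M)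
    (hrs : ∀ k, k + 1 < n → r k * s k = 1) (hsr : ∀ k, k + 1 < n → s k * r k = 1)
    (hl : ∀ k, l (k + 1) = r k * l k * s k)
    (hfar : ∀ j k, j + 1 < k → k + 1 < n → Commute (r j) (r k))
    (hbr : ∀ k, k + 2 < n → r k * r (k + 1) * r k = r (k + 1) * r k * r (k + 1))
    (h0 : ∀ k, 1 ≤ k → k + 1 < n → Commute (r k) (l 0))
    (href : 1 < n → r 0 * l 0 * r 0 * l 0 = l 0 * r 0 * l 0 * r 0)
    (k : ℕ) (hk : k + 1 < n) :
    Commute (r k) ((List.range n).map l).prod := by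
  have A : ∀ j k, j < k → k + 1 < n → Commute (r k) (l j) := by
    intro j
    induction j with
    | zero => intro k h1 h2; exact h0 k h1 h2
    | succ j ih =>
      intro k h1 h2
      rw [hl]
      have hc := (hfar j k h1 h2).symm
      exact (hc.mul_right (ih k (by omega) h2)).mul_right
        (aux_comm_inv (hrs j (by omega)) (hsr j (by omega)) hc)
  have B : ∀ k, k + 1 < n → r k * l k * r k * l k = l k * r k * l k * r k := by
    intro k
    induction k with
    | zero => intro h; exact href h
    | succ k ih =>
      intro h
      rw [hl]
      exact aux_step (hrs k (by omega)) (hsr k (by omega)) (hrs (k + 1) h) (hsr (k + 1) h)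
        (hbr k (by omega)) (A k (k + 1) (by omega) h) (ih (by omega))
  have C : Commute (r k) (l k * l (k + 1)) := by
    show r k * (l k * l (k + 1)) = l k * l (k + 1) * r k
    rw [hl]
    calc r k * (l k * (r k * l k * s k)) = (r k * l k * r k * l k) * s k := by
          simp only [mul_assoc]
      _ = l k * r k * l k * (r k * s k) := by rw [B k hk]; simp only [mul_assoc]
      _ = l k * r k * l k * (s k * r k) := by rw [hrs k hk, hsr k hk]
      _ = _ := by simp only [mul_assoc]
  have D : ∀ j, k + 2 ≤ j → j < n → Commute (r k) (l j) := by
    intro j hj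
    induction j, hj using Nat.le_induction with
    | base =>
      intro h
      rw [hl, hl]
      exact aux_two (hrs k hk) (hsr k hk) (hrs (k + 1) h) (hsr (k + 1) h)
        (hbr k h) (A k (k + 1) (by omega) h)
    | succ j hj ih =>
      intro h
      rw [hl]
      have hc := hfar k j hj h
      exact (hc.mul_right (ih (by omega))).mul_right
        (aux_comm_inv (hrs j (by omega)) (hsr j (by omega)) hc)
  have E : ∀ m, m ≤ k → Commute (r k) ((List.range m).map l).prod := by
    intro m
    induction m with
    | zero => intro _; simp
    | succ m ih =>
      intro h
      rw [List.range_succ, List.map_append, List.prod_append]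
      simpa using (ih (by omega)).mul_right (A m k h hk)
  have F : ∀ m, k + 2 ≤ m → m ≤ n → Commute (r k) ((List.range m).map l).prod := by
    intro m hm
    induction m, hm using Nat.le_induction with
    | base =>
      intro _
      rw [List.range_succ, List.range_succ]
      have := (E k le_rfl).mul_right C
      simpa [mul_assoc] using this
    | succ m hm ih =>
      intro h
      rw [List.range_succ, List.map_append, List.prod_append]
      simpa using (ih (by omega)).mul_right (D m hm h)
  exact F n hk le_rfl

end Abstract

section Amp

open Classical in
/-- Amplification along an injective map of tensor positions. -/
noncomputable def amp {A : Type*} [Semiring A] {X κ ι : Type*} (f : κ → ι)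
    (M : Matrix (κ → X) (κ → X) A) : Matrix (ι → X) (ι → X) A := fun i j =>
  if ∀ p, p ∉ Set.range f → i p = j p then M (i ∘ f) (j ∘ f) else 0

variable {A : Type*} [Semiring A] {X κ ι : Type*} [Fintype X] [DecidableEq X]
  [Fintype κ] [Fintype ι] [DecidableEq κ] [DecidableEq ι]

lemma amp_mul (f : κ → ι) (hf : Function.Injective f) (M M' : Matrix (κ → X) (κ → X) A) :
    amp f (M * M') = amp f M * amp f M' := by
  classical
  ext i j
  rw [Matrix.mul_apply]
  have hinj : Function.Injective (fun g : κ → X => Function.extend f g i) := by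
    intro g g' h
    funext x
    have := congrFun h (f x)
    simpa [hf.extend_apply] using this
  have hz : ∀ k : ι → X, k ∉ Finset.univ.image (fun g : κ → X => Function.extend f g i) →
      amp f M i k * amp f M' k j = 0 := by
    intro k hk
    have : amp f M i k = 0 := by
      unfold amp
      rw [if_neg]
      intro h
      apply hk
      rw [Finset.mem_image]
      refine ⟨k ∘ f, Finset.mem_univ _, ?_⟩
      funext p
      by_cases hp : ∃ x, f x = p
      · obtain ⟨x, rfl⟩ := hp
        simp [hf.extend_apply]
      · rw [Function.extend_apply' _ _ _ hp]
        exact h p hp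
    rw [this, zero_mul]
  rw [← Finset.sum_subset (Finset.subset_univ _) (fun k _ hk => hz k hk),
    Finset.sum_image (fun a _ b _ h => hinj h)]
  have h1 : ∀ g : κ → X, (Function.extend f g i) ∘ f = g := fun g => by
    funext x; simp [hf.extend_apply]
  have h2 : ∀ g : κ → X, ∀ p, p ∉ Set.range f → Function.extend f g i p = i p :=
    fun g p hp => Function.extend_apply' _ _ _ hp
  have h3 : ∀ g : κ → X, amp f M i (Function.extend f g i) = M (i ∘ f) g := by
    intro g
    unfold amp
    rw [if_pos (fun p hp => (h2 g p hp).symm), h1]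
  have h4 : ∀ g : κ → X, amp f M' (Function.extend f g i) j =
      if ∀ p, p ∉ Set.range f → i p = j p then M' g (j ∘ f) else 0 := by
    intro g
    unfold amp
    rw [h1]
    congr 1
    apply propext
    refine forall_congr' fun p => forall_congr' fun hp => ?_
    rw [h2 g p hp]
  simp only [h3, h4]
  unfold amp
  split_ifs
  · rw [Matrix.mul_apply]
  · simp

open Classical in
lemma amp_disj {κ' : Type*} [Fintype κ'] (f : κ → ι) (g : κ' → ι)
    (hd : ∀ x y, f x ≠ g y)
    (M : Matrix (κ → X) (κ → X) A) (M' : Matrix (κ' → X) (κ' → X) A) (i j : ι → X) :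
    (amp f M * amp g M') i j =
      if ∀ p, p ∉ Set.range f → p ∉ Set.range g → i p = j p then
        M (i ∘ f) (j ∘ f) * M' (i ∘ g) (j ∘ g) else 0 := by
  rw [Matrix.mul_apply,
    Finset.sum_eq_single (fun p => if p ∈ Set.range f then j p else i p)]
  · have e1 : (fun p => if p ∈ Set.range f then j p else i p) ∘ f = j ∘ f := by
      funext x; simp
    have e2 : (fun p => if p ∈ Set.range f then j p else i p) ∘ g = i ∘ g := by
      funext x
      have : ¬ ∃ y, f y = g x := fun ⟨y, hy⟩ => hd y x hy
      simp [this]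
    unfold amp
    rw [e1, e2, if_pos (fun p hp => by simp only [if_neg hp])]
    by_cases h : ∀ p, p ∉ Set.range f → p ∉ Set.range g → i p = j p
    · rw [if_pos h, if_pos]
      intro p hp
      by_cases hpf : p ∈ Set.range f
      · simp only [if_pos hpf]
      · simp only [if_neg hpf]; exact h p hpf hp
    · rw [if_neg h, if_neg, mul_zero]
      intro h'
      apply h
      intro p hp hpg
      have := h' p hpg
      simpa only [if_neg hp] using this
  · intro k _ hk
    unfold amp
    by_cases h1 : ∀ p, p ∉ Set.range f → i p = k p
    · by_cases h2 : ∀ p, p ∉ Set.range g → k p = j p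
      · exfalso
        apply hk
        funext p
        by_cases hp : p ∈ Set.range f
        · rw [if_pos hp]
          apply h2
          rintro ⟨y, rfl⟩
          obtain ⟨x, hx⟩ := hp
          exact hd x y hx
        · rw [if_neg hp, h1 p hp]
      · rw [if_neg h2, mul_zero]
    · rw [if_neg h1, zero_mul]
  · intro h; exact absurd (Finset.mem_univ _) h

lemma amp_commute {κ' : Type*} [Fintype κ'] (f : κ → ι) (g : κ' → ι)
    (hd : ∀ x y, f x ≠ g y)
    (M : Matrix (κ → X) (κ → X) A) (M' : Matrix (κ' → X) (κ' → X) A)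
    (hM : ∀ a b c d, Commute (M a b) (M' c d)) : Commute (amp f M) (amp g M') := by
  classical
  show amp f M * amp g M' = amp g M' * amp f M
  ext i j
  rw [amp_disj f g hd]
  by_cases h : ∀ p, p ∉ Set.range f → p ∉ Set.range g → i p = j p
  · have := amp_disj g f (fun x y => (hd y x).symm) M' M i j
    rw [if_pos (fun p h1 h2 => h p h2 h1)] at this
    rw [this, if_pos h]
    exact hM _ _ _ _
  · have := amp_disj g f (fun x y => (hd y x).symm) M' M i j
    rw [if_neg (fun h' => h fun p h1 h2 => h' p h2 h1)] at this
    rw [this, if_neg h]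

end Amp

section Concrete

variable {A : Type*} [Semiring A]

/-- Positions k, k+1, ... -/
def shiftF (m n k : ℕ) (h : k + m ≤ n) : Fin m → Fin n := fun p => ⟨k + p, by omega⟩

lemma shiftF_inj (m n k : ℕ) (h : k + m ≤ n) : Function.Injective (shiftF m n k h) := by
  intro a b hab
  have := congrArg Fin.val hab
  simp only [shiftF] at this
  exact Fin.ext (by omega)

lemma not_mem_shiftF (m n k : ℕ) (h : k + m ≤ n) (p : Fin n) :
    p ∉ Set.range (shiftF m n k h) ↔ (p : ℕ) < k ∨ k + m ≤ p := by
  constructor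
  · intro hp
    by_contra hc
    push Not at hc
    exact hp ⟨⟨p - k, by omega⟩, Fin.ext (by simp only [shiftF]; omega)⟩
  · rintro hp ⟨x, rfl⟩
    simp only [shiftF] at hp
    have := x.2
    omega

lemma ampl2_eq (N n : ℕ) (M : Matrix (Fin N × Fin N) (Fin N × Fin N) A) (k : ℕ)
    (h : k + 2 ≤ n) :
    ampl2 N n M k = amp (shiftF 2 n k h)
      (M.submatrix (finTwoArrowEquiv (Fin N)) (finTwoArrowEquiv (Fin N))) := by
  classical
  ext i j
  unfold ampl2 amp
  rw [dif_pos (show k + 1 < n by omega)]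
  have hiff : (∀ m : Fin n, (m : ℕ) ≠ k → (m : ℕ) ≠ k + 1 → i m = j m) ↔
      ∀ p, p ∉ Set.range (shiftF 2 n k h) → i p = j p := by
    refine forall_congr' fun p => ?_
    rw [not_mem_shiftF]
    constructor
    · intro h1 h2; exact h1 (by omega) (by omega)
    · intro h1 h2 h3; exact h1 (by omega)
  by_cases hc : ∀ p, p ∉ Set.range (shiftF _ n _ h) → i p = j p
  · rw [if_pos (hiff.mpr hc), if_pos hc]; rfl
  · rw [if_neg (fun h' => hc (hiff.mp h')), if_neg hc]

lemma ampl2_mul (N n : ℕ) (M M' : Matrix (Fin N × Fin N) (Fin N × Fin N) A) (k : ℕ)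
    (h : k + 1 < n) :
    ampl2 N n (M * M') k = ampl2 N n M k * ampl2 N n M' k := by
  rw [ampl2_eq N n _ k h, ampl2_eq N n _ k h, ampl2_eq N n _ k h,
    ← amp_mul _ (shiftF_inj _ _ _ _), Matrix.submatrix_mul_equiv]

lemma ampl2_one (N n : ℕ) (k : ℕ) (h : k + 1 < n) :
    ampl2 N n (1 : Matrix (Fin N × Fin N) (Fin N × Fin N) A) k = 1 := by
  ext i j
  unfold ampl2
  rw [dif_pos h]
  by_cases hij : i = j
  · subst hij; simp
  · rw [Matrix.one_apply_ne hij]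
    split_ifs with h1
    · rw [Matrix.one_apply_ne]
      intro h2
      apply hij
      funext m
      simp only [Prod.mk.injEq] at h2
      by_cases hm : (m : ℕ) = k
      · have : m = ⟨k, by omega⟩ := Fin.ext hm
        rw [this]; exact h2.1
      · by_cases hm' : (m : ℕ) = k + 1
        · have : m = ⟨k + 1, h⟩ := Fin.ext hm'
          rw [this]; exact h2.2
        · exact h1 m hm hm'
    · rfl

lemma ampl2_amp3 (N n : ℕ) (M : Matrix (Fin N × Fin N) (Fin N × Fin N) A) (k e : ℕ)
    (he : e < 2) (h : k + 3 ≤ n) :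
    ampl2 N n M (k + e) = amp (shiftF 3 n k h) (ampl2 N 3 M e) := by
  classical
  ext i j
  unfold ampl2 amp
  rw [dif_pos (show k + e + 1 < n by omega)]
  have he3 : e + 1 < 3 := by omega
  have hiff : (∀ m : Fin n, (m : ℕ) ≠ k + e → (m : ℕ) ≠ k + e + 1 → i m = j m) ↔
      (∀ p, p ∉ Set.range (shiftF 3 n k h) → i p = j p) ∧
      (∀ m : Fin 3, (m : ℕ) ≠ e → (m : ℕ) ≠ e + 1 →
        (i ∘ shiftF 3 n k h) m = (j ∘ shiftF 3 n k h) m) := by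
    constructor
    · intro H
      refine ⟨fun p hp => ?_, fun m h1 h2 => ?_⟩
      · rw [not_mem_shiftF] at hp
        exact H p (by omega) (by omega)
      · exact H _ (by simp only [shiftF]; omega) (by simp only [shiftF]; omega)
    · rintro ⟨H1, H2⟩ m h1 h2
      by_cases hm : m ∈ Set.range (shiftF 3 n k h)
      · obtain ⟨x, rfl⟩ := hm
        simp only [shiftF] at h1 h2
        exact H2 x (by omega) (by omega)
      · exact H1 m hm
  by_cases hc : ∀ p, p ∉ Set.range (shiftF 3 n k h) → i p = j p
  · rw [if_pos hc]
    show _ = dite _ _ _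
    rw [dif_pos he3]
    by_cases hc2 : ∀ m : Fin 3, (m : ℕ) ≠ e → (m : ℕ) ≠ e + 1 →
        (i ∘ shiftF 3 n k h) m = (j ∘ shiftF 3 n k h) m
    · rw [if_pos (hiff.mpr ⟨hc, hc2⟩), if_pos hc2]; rfl
    · rw [if_neg (fun h' => hc2 (hiff.mp h').2), if_neg hc2]
  · rw [if_neg (fun h' => hc (hiff.mp h').1), if_neg hc]

lemma ampl2_map {B : Type*} [Semiring B] (φ : A →+* B) (N n : ℕ)
    (M : Matrix (Fin N × Fin N) (Fin N × Fin N) A) (k : ℕ) :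
    (ampl2 N n M k).map φ = ampl2 N n (M.map φ) k := by
  ext i j
  simp only [Matrix.map_apply]
  unfold ampl2
  split_ifs <;> simp

lemma ampl1_eq (N n : ℕ) (L : Matrix (Fin N) (Fin N) A) (h : 0 + 1 ≤ n) :
    ampl1 N n L 0 = amp (shiftF 1 n 0 h) (fun i j => L (i 0) (j 0)) := by
  classical
  ext i j
  unfold ampl1 amp
  rw [dif_pos (show 0 < n by omega)]
  have hiff : (∀ m : Fin n, (m : ℕ) ≠ 0 → i m = j m) ↔
      ∀ p, p ∉ Set.range (shiftF 1 n 0 h) → i p = j p := by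
    refine forall_congr' fun p => ?_
    rw [not_mem_shiftF]
    constructor
    · intro h1 h2; exact h1 (by omega)
    · intro h1 h2; exact h1 (by omega)
  by_cases hc : ∀ p, p ∉ Set.range (shiftF _ n _ h) → i p = j p
  · rw [if_pos (hiff.mpr hc), if_pos hc]; rfl
  · rw [if_neg (fun h' => hc (hiff.mp h')), if_neg hc]

/-- L⊗I. -/
def L1A {N : ℕ} (L : Matrix (Fin N) (Fin N) A) :
    Matrix (Fin N × Fin N) (Fin N × Fin N) A :=
  fun p r => if p.2 = r.2 then L p.1 r.1 else 0

lemma ampl1_eq2 (N n : ℕ) (L : Matrix (Fin N) (Fin N) A) (h : 1 < n) :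
    ampl1 N n L 0 = ampl2 N n (L1A L) 0 := by
  ext i j
  unfold ampl1 ampl2
  rw [dif_pos (show 0 < n by omega), dif_pos (show 0 + 1 < n by omega)]
  have hiff : (∀ m : Fin n, (m : ℕ) ≠ 0 → i m = j m) ↔
      (∀ m : Fin n, (m : ℕ) ≠ 0 → (m : ℕ) ≠ 0 + 1 → i m = j m) ∧
      i ⟨0 + 1, h⟩ = j ⟨0 + 1, h⟩ := by
    constructor
    · intro H
      exact ⟨fun m h1 _ => H m h1, H _ (by simp)⟩
    · rintro ⟨H1, H2⟩ m hm
      by_cases hm' : (m : ℕ) = 0 + 1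
      · have : m = ⟨0 + 1, h⟩ := Fin.ext hm'
        rw [this]; exact H2
      · exact H1 m hm hm'
  simp only [hiff, ite_and, L1A]

end Concrete

lemma REA_refl (N : ℕ) (R : Matrix (Fin N × Fin N) (Fin N × Fin N) ℂ) :
    let L1 := L1A (Lgen N R)
    let RA := R.map (algebraMap ℂ (REA N R))
    RA * L1 * RA * L1 = L1 * RA * L1 * RA := by
  intro L1 RA
  let φ := RingQuot.mkAlgHom ℂ (REArel N R)
  have hL : (L1F N).map φ = L1 := by
    ext p r
    simp only [Matrix.map_apply, L1F, L1, L1A, Lgen]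
    split_ifs
    · rfl
    · simp
  have hR : (R.map (algebraMap ℂ (FreeAlgebra ℂ (Fin N × Fin N)))).map φ = RA := by
    ext p r
    simp only [Matrix.map_apply, RA]
    exact φ.commutes _
  have key : (R.map (algebraMap ℂ (FreeAlgebra ℂ (Fin N × Fin N))) * L1F N *
            R.map (algebraMap ℂ (FreeAlgebra ℂ (Fin N × Fin N))) * L1F N).map φ =
      (L1F N * R.map (algebraMap ℂ (FreeAlgebra ℂ (Fin N × Fin N))) * L1F N *
            R.map (algebraMap ℂ (FreeAlgebra ℂ (Fin N × Fin N)))).map φ := by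
    ext p r
    exact RingQuot.mkAlgHom_rel ℂ (REArel.rel p r)
  simpa only [Matrix.map_mul, hL, hR] using key

/-- Tr_{R(1…n)}( P · L_{\bar{1→n}} ) = Tr_{R(1…n)}( L_{\bar{1→n}} · P )
for any polynomial P in R₁,…,R_{n−1}. -/
theorem statement_7 (N : ℕ) (hN : 1 ≤ N) (q : ℂ) (hq0 : q ≠ 0) (hq1 : q ≠ 1) (hqm1 : q ≠ -1)
    (R : Matrix (Fin N × Fin N) (Fin N × Fin N) ℂ)
    (hbraid : ampl2 N 3 R 0 * ampl2 N 3 R 1 * ampl2 N 3 R 0 =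
      ampl2 N 3 R 1 * ampl2 N 3 R 0 * ampl2 N 3 R 1)
    (hHecke : (q • (1 : Matrix (Fin N × Fin N) (Fin N × Fin N) ℂ) - R) * (q⁻¹ • 1 + R) = 0)
    (Ψ : Matrix (Fin N × Fin N) (Fin N × Fin N) ℂ)
    (hΨ : ∀ i j k m : Fin N, ∑ a : Fin N, ∑ b : Fin N,
        R (i, b) (j, a) * Ψ (a, k) (b, m) = if i = m ∧ k = j then 1 else 0)
    (C : Matrix (Fin N) (Fin N) ℂ)
    (hC : ∀ i j : Fin N, C i j = ∑ k : Fin N, Ψ (i, k) (j, k))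
    (n : ℕ) (hn : 1 ≤ n)
    (P : Matrix (Fin n → Fin N) (Fin n → Fin N) ℂ)
    (hP : P ∈ Algebra.adjoin ℂ
      {M : Matrix (Fin n → Fin N) (Fin n → Fin N) ℂ | ∃ k : ℕ, k + 1 < n ∧ M = ampl2 N n R k}) :
    trRn N n C (P.map (algebraMap ℂ (REA N R)) * Ltot N n R q (Lgen N R)) =
      trRn N n C (Ltot N n R q (Lgen N R) * P.map (algebraMap ℂ (REA N R))) := by
  have hRS : R * (R - (q - q⁻¹) • 1) = 1 := by
    have h1 : (q • (1 : Matrix (Fin N × Fin N) (Fin N × Fin N) ℂ) - R) * (q⁻¹ • 1 + R) =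
        1 - R * (R - (q - q⁻¹) • 1) := by
      simp only [sub_mul, mul_add, mul_sub, smul_mul_assoc, mul_smul_comm, one_mul, mul_one,
        sub_smul, smul_sub]
      rw [smul_smul, inv_mul_cancel₀ hq0, one_smul]
      abel
    rw [h1] at hHecke
    exact (sub_eq_zero.mp hHecke).symm
  have hSR : (R - (q - q⁻¹) • 1) * R = 1 := mul_eq_one_comm.mp hRS
  let α := algebraMap ℂ (REA N R)
  have hbraidA : ampl2 N 3 (R.map α) 0 * ampl2 N 3 (R.map α) 1 * ampl2 N 3 (R.map α) 0 =
      ampl2 N 3 (R.map α) 1 * ampl2 N 3 (R.map α) 0 * ampl2 N 3 (R.map α) 1 := by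
    have := congrArg (fun X => Matrix.map X α) hbraid
    simpa only [Matrix.map_mul, ampl2_map] using this
  have main : ∀ k, k + 1 < n →
      Commute (ampl2 N n (R.map α) k) (Ltot N n R q (Lgen N R)) := by
    intro k hk
    refine abstract_comm n (fun k => ampl2 N n (R.map α) k)
      (fun k => ampl2 N n ((R - (q - q⁻¹) • 1).map α) k) (Lbar N n R q (Lgen N R))
      ?_ ?_ ?_ ?_ ?_ ?_ ?_ k hk
    · intro k hk
      show ampl2 N n _ k * ampl2 N n _ k = 1
      rw [← ampl2_mul N n _ _ k hk, ← Matrix.map_mul, hRS,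
        Matrix.map_one _ (map_zero α) (map_one α), ampl2_one N n k hk]
    · intro k hk
      show ampl2 N n _ k * ampl2 N n _ k = 1
      rw [← ampl2_mul N n _ _ k hk, ← Matrix.map_mul, hSR,
        Matrix.map_one _ (map_zero α) (map_one α), ampl2_one N n k hk]
    · intro k
      rfl
    · intro j k hj hk
      show Commute (ampl2 N n _ j) (ampl2 N n _ k)
      rw [ampl2_eq N n _ j (by omega), ampl2_eq N n _ k (by omega)]
      apply amp_commute
      · intro x y h
        have := congrArg Fin.val h
        simp only [shiftF] at this
        omega
      · intro a b c d
        exact Algebra.commutes (A := REA N R) (R (finTwoArrowEquiv (Fin N) a) (finTwoArrowEquiv (Fin N) b)) _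
    · intro k hk
      show ampl2 N n _ (k + 0) * ampl2 N n _ (k + 1) * ampl2 N n _ (k + 0) =
        ampl2 N n _ (k + 1) * ampl2 N n _ (k + 0) * ampl2 N n _ (k + 1)
      rw [ampl2_amp3 N n _ k 0 (by omega) hk, ampl2_amp3 N n _ k 1 (by omega) hk]
      simp only [← amp_mul _ (shiftF_inj _ _ _ _)]
      rw [hbraidA]
    · intro k hk1 hk
      show Commute (ampl2 N n _ k) (ampl1 N n _ 0)
      rw [ampl2_eq N n _ k (by omega), ampl1_eq N n _ (by omega)]
      apply amp_commute
      · intro x y h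
        have := congrArg Fin.val h
        simp only [shiftF] at this
        omega
      · intro a b c d
        exact Algebra.commutes (A := REA N R) (R (finTwoArrowEquiv (Fin N) a) (finTwoArrowEquiv (Fin N) b)) _
    · intro h
      show ampl2 N n _ 0 * ampl1 N n _ 0 * ampl2 N n _ 0 * ampl1 N n _ 0 =
        ampl1 N n _ 0 * ampl2 N n _ 0 * ampl1 N n _ 0 * ampl2 N n _ 0
      rw [ampl1_eq2 N n _ h]
      simp only [← ampl2_mul N n _ _ 0 h]
      rw [REA_refl N R]
  have hcomm : Commute (P.map α) (Ltot N n R q (Lgen N R)) := by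
    induction hP using Algebra.adjoin_induction with
    | mem x hx =>
      obtain ⟨k, hk, rfl⟩ := hx
      rw [ampl2_map]
      exact main k hk
    | algebraMap c =>
      have : (algebraMap ℂ (Matrix (Fin n → Fin N) (Fin n → Fin N) ℂ) c).map α =
          algebraMap ℂ (Matrix (Fin n → Fin N) (Fin n → Fin N) (REA N R)) c := by
        ext i j
        simp only [Matrix.map_apply, Matrix.algebraMap_matrix_apply]
        split_ifs <;> simp [α]
      rw [this]
      exact Algebra.commutes _ _
    | add x y _ _ hx hy =>
      rw [Matrix.map_add _ (map_add α)]
      exact hx.add_left hy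
    | mul x y _ _ hx hy =>
      rw [Matrix.map_mul]
      exact hx.mul_left hy
  exact congrArg _ hcomm.eq
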